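/- Let A be a bounded hoop, u ∈ A with u·u = u, and φ : A → 2 a bounded hoop homomorphism into the two-element bounded hoop 2. Let ι : 2 → A send 0 to 0 and 1 to 1, and define f : A → A by f(x) = (u → x)·(¬u → ι(φ(x))). Then f is a bounded hoop endomorphism of A: f(x·y) = f(x)·f(y), f(x → y) = f(x) → f(y), f(1) = 1 and f(0) = 0. -/

import Mathlib

/-- A hoop: a commutative monoid `(α, ·, 1)` with an operation `→` satisfying
`x → x = 1`, divisibility `x·(x → y) = y·(y → x)`, and
`x → (y → z) = (x·y) → z`. -/
class Hoop (α : Type) where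
  mul : α → α → α
  himp : α → α → α
  one : α
  mul_comm : ∀ a b : α, mul a b = mul b a
  mul_assoc : ∀ a b c : α, mul (mul a b) c = mul a (mul b c)
  mul_one : ∀ a : α, mul a one = a
  himp_self : ∀ a : α, himp a a = one
  div : ∀ a b : α, mul a (himp a b) = mul b (himp b a)
  himp_himp : ∀ a b c : α, himp a (himp b c) = himp (mul a b) c

/-- A bounded hoop: a hoop with a least element `0` (i.e. `0 → x = 1`). -/
class BHoop (α : Type) extends Hoop α where
  zero : α
  zero_himp : ∀ a : α, himp zero a = one

/-- A bounded hoop homomorphism preserves `·`, `→`, `1` and `0`. -/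
def IsBHoopHom {α β : Type} [BHoop α] [BHoop β] (f : α → β) : Prop :=
  (∀ a b : α, f (Hoop.mul a b) = Hoop.mul (f a) (f b)) ∧
  (∀ a b : α, f (Hoop.himp a b) = Hoop.himp (f a) (f b)) ∧
  f Hoop.one = Hoop.one ∧ f BHoop.zero = BHoop.zero

/-- Negation in a bounded hoop: `¬x = x → 0`. -/
def BHoop.neg {α : Type} [BHoop α] (a : α) : α := Hoop.himp a BHoop.zero

/-- The two-element bounded hoop `2`, realized on `Bool`. -/
instance : BHoop Bool where
  mul := and
  himp x y := !x || y
  one := true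
  zero := false
  mul_comm := by decide
  mul_assoc := by decide
  mul_one := by decide
  himp_self := by decide
  div := by decide
  himp_himp := by decide
  zero_himp := by decide

namespace HoopAux

local infixl:70 "⊙" => Hoop.mul
local infixr:60 "⟶ₕ" => Hoop.himp

variable {A : Type}

section H
variable [Hoop A]

/-- The hoop order. -/
def le (a b : A) : Prop := a ⟶ₕ b = Hoop.one

lemma antisymm {a b : A} (h : le a b) (k : le b a) : a = b := by
  have := Hoop.div a b
  rw [show a ⟶ₕ b = Hoop.one from h, show b ⟶ₕ a = Hoop.one from k] at this
  simpa [Hoop.mul_one] using this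

lemma one_mul (a : A) : Hoop.one ⊙ a = a := by rw [Hoop.mul_comm, Hoop.mul_one]

lemma one_himp (a : A) : Hoop.one ⟶ₕ a = a := by
  have h1 : (Hoop.one : A) ⟶ₕ a = a ⊙ (a ⟶ₕ Hoop.one) := by
    rw [← Hoop.div, one_mul]
  have h2 : a ⟶ₕ (Hoop.one ⟶ₕ a) = Hoop.one := by
    rw [Hoop.himp_himp, Hoop.mul_one, Hoop.himp_self]
  have h3 : (Hoop.one ⟶ₕ a) ⟶ₕ a = (a ⟶ₕ Hoop.one) ⟶ₕ Hoop.one := by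
    rw [h1, Hoop.mul_comm, ← Hoop.himp_himp, Hoop.himp_self]
  have h4 := Hoop.div a (Hoop.one ⟶ₕ a)
  rw [h2, h3, Hoop.mul_one] at h4
  have h5 : a = a ⊙ (a ⟶ₕ Hoop.one) := by
    conv_lhs => rw [h4, h1, Hoop.mul_assoc, Hoop.div (a ⟶ₕ Hoop.one), one_mul,
      Hoop.himp_himp, one_mul]
  rw [h1, ← h5]

lemma himp_one (a : A) : a ⟶ₕ Hoop.one = Hoop.one := by
  have h1 : a = a ⊙ (a ⟶ₕ Hoop.one) := by
    conv_lhs => rw [← one_himp a, ← one_mul (Hoop.one ⟶ₕ a), Hoop.div]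
  have h2 : (a ⊙ (a ⟶ₕ Hoop.one)) ⟶ₕ Hoop.one = Hoop.one := by
    rw [Hoop.mul_comm, ← Hoop.himp_himp, Hoop.himp_self]
  rwa [← h1] at h2

lemma refl (a : A) : le a a := Hoop.himp_self a

lemma trans {a b c : A} (h : le a b) (k : le b c) : le a c := by
  have h1 : a = (b ⟶ₕ a) ⊙ b := by
    rw [Hoop.mul_comm, ← Hoop.div, show a ⟶ₕ b = Hoop.one from h, Hoop.mul_one]
  unfold le at *
  rw [h1, ← Hoop.himp_himp, k, himp_one]

lemma res {a b c : A} : le (a ⊙ b) c ↔ le a (b ⟶ₕ c) := by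
  unfold le; rw [Hoop.himp_himp]

lemma mul_le_right (a b : A) : le (a ⊙ b) b := by
  unfold le; rw [← Hoop.himp_himp, Hoop.himp_self, himp_one]

lemma mul_le_left (a b : A) : le (a ⊙ b) a := by
  rw [Hoop.mul_comm]; exact mul_le_right b a

lemma mono_left {a b : A} (c : A) (h : le a b) : le (a ⊙ c) (b ⊙ c) :=
  res.2 (trans h (res.1 (refl _)))

lemma mono {a b c d : A} (h : le a b) (k : le c d) : le (a ⊙ c) (b ⊙ d) := by
  refine trans (mono_left c h) ?_
  rw [Hoop.mul_comm b c, Hoop.mul_comm b d]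
  exact mono_left b k

lemma mp (a b : A) : le ((a ⟶ₕ b) ⊙ a) b := res.2 (refl _)

lemma le_himp (a b : A) : le b (a ⟶ₕ b) := res.1 (mul_le_left b a)

lemma himp_mono (c : A) {a b : A} (h : le a b) : le (c ⟶ₕ a) (c ⟶ₕ b) :=
  res.1 (trans (mp c a) h)

lemma mul_himp_of_le {a b : A} (h : le a b) : b ⊙ (b ⟶ₕ a) = a := by
  rw [← Hoop.div, show a ⟶ₕ b = Hoop.one from h, Hoop.mul_one]

lemma idem_mul {v t : A} (hv : v ⊙ v = v) (h : le t v) : v ⊙ t = t := by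
  rw [← mul_himp_of_le h, ← Hoop.mul_assoc, hv]

lemma idem_himp_mul {u : A} (hu : u ⊙ u = u) (x : A) : u ⊙ (u ⟶ₕ x) = u ⊙ x := by
  apply antisymm
  · have h : le (u ⊙ (u ⟶ₕ x)) x := by rw [Hoop.mul_comm]; exact mp u x
    rw [← hu, Hoop.mul_assoc]
    rw [hu]
    exact mono (refl u) h
  · exact mono (refl u) (le_himp u x)

lemma swap4 (a b c d : A) : (a ⊙ b) ⊙ (c ⊙ d) = (a ⊙ c) ⊙ (b ⊙ d) := by
  rw [Hoop.mul_assoc, ← Hoop.mul_assoc b, Hoop.mul_comm b c, Hoop.mul_assoc c, ← Hoop.mul_assoc a]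

/-- `u → -` is multiplicative for idempotent `u`. -/
lemma himp_mul {u : A} (hu : u ⊙ u = u) (x y : A) :
    u ⟶ₕ (x ⊙ y) = (u ⟶ₕ x) ⊙ (u ⟶ₕ y) := by
  obtain ⟨a, ha⟩ : ∃ a, a = u ⟶ₕ (x ⊙ y) := ⟨_, rfl⟩
  obtain ⟨r, hr⟩ : ∃ r, r = (u ⟶ₕ x) ⊙ (u ⟶ₕ y) := ⟨_, rfl⟩
  have hua : u ⊙ a = u ⊙ r := by
    rw [ha, hr, idem_himp_mul hu]
    have h := swap4 u u (u ⟶ₕ x) (u ⟶ₕ y)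
    rw [idem_himp_mul hu, idem_himp_mul hu, swap4 u x, hu] at h
    exact h.symm
  have hra : le r a := by
    rw [ha]; apply res.1
    rw [Hoop.mul_comm, ← hua, ha, Hoop.mul_comm]; exact mp _ _
  have hue : le u (a ⟶ₕ r) := by
    apply res.1; rw [hua]; exact mul_le_right _ _
  have hae : le a (a ⟶ₕ r) := by
    apply res.1
    rw [hr]
    apply mono <;> rw [ha]
    · exact himp_mono u (mul_le_left x y)
    · exact himp_mono u (mul_le_right x y)
  have heu : (a ⟶ₕ r) ⊙ u = u := by
    apply antisymm (mul_le_right _ _)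
    conv => arg 1; rw [← hu]
    exact mono_left u hue
  have hea : (a ⟶ₕ r) ⟶ₕ a = a := by
    conv_lhs => rw [ha, Hoop.himp_himp, ← ha, heu]
    exact ha.symm
  have h1 := mul_himp_of_le hae
  rw [hea, Hoop.mul_comm, mul_himp_of_le hra] at h1
  rw [← ha, ← hr, h1]

lemma himp_himp_distrib {u : A} (hu : u ⊙ u = u) (x y : A) :
    u ⟶ₕ (x ⟶ₕ y) = (u ⟶ₕ x) ⟶ₕ (u ⟶ₕ y) := by
  rw [Hoop.himp_himp, Hoop.himp_himp, Hoop.mul_comm (u ⟶ₕ x), idem_himp_mul hu]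

lemma himp_mul_of {p q v : A} (hv : v ⊙ v = v) (h : le (p ⟶ₕ v) v) :
    p ⟶ₕ (q ⊙ v) = (p ⟶ₕ q) ⊙ v := by
  apply antisymm
  · have h1 : le (p ⟶ₕ (q ⊙ v)) v := trans (himp_mono p (mul_le_right q v)) h
    rw [← idem_mul hv h1, Hoop.mul_comm v]
    exact mono_left v (himp_mono p (mul_le_left q v))
  · apply res.1
    rw [Hoop.mul_assoc, Hoop.mul_comm v, ← Hoop.mul_assoc]
    exact mono_left v (mp p q)

end H

variable [BHoop A]

lemma zero_le (a : A) : le BHoop.zero a := BHoop.zero_himp a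

lemma zero_mul (a : A) : BHoop.zero ⊙ a = BHoop.zero :=
  antisymm (mul_le_left _ _) (zero_le _)

lemma neg_idem {u : A} (hu : u ⊙ u = u) : BHoop.neg u ⊙ BHoop.neg u = BHoop.neg u := by
  unfold BHoop.neg
  rw [← himp_mul hu, zero_mul]

lemma mul_neg_neg (u : A) : le u (BHoop.neg (BHoop.neg u)) := by
  unfold BHoop.neg
  apply res.1; rw [Hoop.mul_comm]; exact mp _ _

lemma neg_mul_neg_neg (u : A) : BHoop.neg u ⊙ BHoop.neg (BHoop.neg u) = BHoop.zero := by
  apply antisymm _ (zero_le _)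
  rw [Hoop.mul_comm]; exact mp _ _

lemma key {u : A} (hu : u ⊙ u = u) (x : A) :
    le ((u ⟶ₕ x) ⟶ₕ BHoop.neg (BHoop.neg u)) (BHoop.neg (BHoop.neg u)) := by
  have h : (u ⟶ₕ x) ⊙ BHoop.neg u = BHoop.neg u := by
    apply antisymm (mul_le_right _ _)
    conv => arg 1; rw [← neg_idem hu]
    exact mono_left _ (himp_mono u (zero_le x))
  unfold BHoop.neg at *
  rw [Hoop.himp_himp, h]
  exact refl _

lemma key2 {u : A} (hu : u ⊙ u = u) (x y : A) :
    ((u ⟶ₕ x) ⊙ BHoop.neg (BHoop.neg u)) ⟶ₕ (u ⟶ₕ y) = (u ⟶ₕ x) ⟶ₕ (u ⟶ₕ y) := by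
  have h : BHoop.neg (BHoop.neg u) ⊙ u = u := by
    apply antisymm (mul_le_right _ _)
    conv => arg 1; rw [← hu]
    exact mono_left _ (mul_neg_neg u)
  rw [Hoop.mul_comm, ← Hoop.himp_himp, ← himp_himp_distrib hu, Hoop.himp_himp, h]

end HoopAux

/-- Given an idempotent `u` in a bounded hoop `A` and a bounded hoop
homomorphism `φ : A → 2`, the map
`f(x) = (u → x)·(¬u → ι(φ x))` (where `ι : 2 → A` sends `0` to `0` and `1` to
`1`) is a bounded hoop endomorphism of `A`. -/
theorem dzik_endomorphism (A : Type) [BHoop A] (u : A)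
    (hu : Hoop.mul u u = u) (φ : A → Bool) (hφ : IsBHoopHom φ) :
    IsBHoopHom (fun x : A =>
      Hoop.mul (Hoop.himp u x)
        (Hoop.himp (BHoop.neg u)
          (if φ x then (Hoop.one : A) else BHoop.zero))) := by
  obtain ⟨hm, hi, h1, h0⟩ := hφ
  have hn := HoopAux.neg_idem hu
  have hv := HoopAux.neg_idem hn
  have hneg : Hoop.himp (BHoop.neg u) BHoop.zero = BHoop.neg (BHoop.neg u) := rfl
  refine ⟨fun x y => ?_, fun x y => ?_, ?_, ?_⟩
  · have hxy : φ (Hoop.mul x y) = (φ x && φ y) := hm x y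
    simp only [hxy]
    rw [HoopAux.himp_mul hu]
    cases hx : φ x <;> cases hy : φ y <;>
      simp [HoopAux.himp_one, Hoop.mul_one, hneg]
    · rw [HoopAux.swap4, hv]
    · rw [Hoop.mul_assoc, Hoop.mul_assoc, Hoop.mul_comm (Hoop.himp u y)]
    · rw [Hoop.mul_assoc]
  · have hxy : φ (Hoop.himp x y) = (!φ x || φ y) := hi x y
    simp only [hxy]
    rw [HoopAux.himp_himp_distrib hu]
    cases hx : φ x <;> cases hy : φ y <;>
      simp [HoopAux.himp_one, Hoop.mul_one, hneg]
    · apply HoopAux.antisymm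
      · apply HoopAux.res.1
        rw [← Hoop.mul_assoc]
        exact HoopAux.mono_left _ (HoopAux.mp _ _)
      · rw [← HoopAux.key2 hu x y]
        exact HoopAux.himp_mono _ (HoopAux.mul_le_left _ _)
    · rw [HoopAux.key2 hu]
    · rw [HoopAux.himp_mul_of hv (HoopAux.key hu x)]
  · have h1' : φ Hoop.one = true := h1
    simp [h1', HoopAux.himp_one, Hoop.mul_one]
  · have h0' : φ BHoop.zero = false := h0
    simp [h0', hneg]
    exact HoopAux.neg_mul_neg_neg u
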